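/- arXiv:1804.02532 — 8 statements merged into one kernel-verified Lean document; each statement's English description precedes it below -/
import Mathlib

section
/- In the Knödel graph W_{Δ,n} with Δ ≥ 2, two distinct vertices u_i and u_j of U have a common neighbor (i.e., N(u_i) ∩ N(u_j) ≠ ∅) if and only if id(u_i, u_j) ∈ M_Δ or n/2 − id(u_i, u_j) ∈ M_Δ. -/
/-- The Knödel graph `W_{Δ,n}` (here `m = n/2`): a bipartite graph on the vertex set
`Bool × ZMod m`, where `(false, i)` plays the role of `u_i` and `(true, j)` the role of `v_j`,
and `u_i` is adjacent to `v_j` iff `j ≡ i + 2^k - 1 (mod m)` for some `0 ≤ k ≤ Δ - 1`. -/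
def knodel (Δ m : ℕ) : SimpleGraph (Bool × ZMod m) :=
  SimpleGraph.fromRel (fun a b =>
    a.1 = false ∧ b.1 = true ∧ ∃ k < Δ, b.2 = a.2 + 2 ^ k - 1)

/-- The index-distance between (the indices of) two vertices `u_i` and `u_j`
of the Knödel graph on `2m` vertices: `id(u_i,u_j) = min{|i-j|, m - |i-j|}`. -/
def idist (m i j : ℕ) : ℕ := min (Nat.dist i j) (m - Nat.dist i j)

/-- The set `M_Δ = {2^a - 2^b : 0 ≤ b < a ≤ Δ - 1}`. -/
def Mset (Δ : ℕ) : Set ℕ := {x | ∃ a b : ℕ, b < a ∧ a < Δ ∧ x = 2 ^ a - 2 ^ b}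

theorem knodel_adj_false_iff {Δ m : ℕ} (x : ZMod m) (w : Bool × ZMod m) :
    (knodel Δ m).Adj (false, x) w ↔ w.1 = true ∧ ∃ k < Δ, w.2 = x + 2 ^ k - 1 := by
  obtain ⟨b, y⟩ := w
  cases b <;> simp [knodel]

theorem knodel_common_neighbor_iff {Δ m : ℕ} (i j : ℕ) :
    ((knodel Δ m).neighborSet (false, (i : ZMod m)) ∩
      (knodel Δ m).neighborSet (false, (j : ZMod m))).Nonempty ↔
    ∃ k < Δ, ∃ l < Δ, (m : ℤ) ∣ (j + 2 ^ l) - (i + 2 ^ k) := by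
  have key (k l : ℕ) : (m : ℤ) ∣ (j + 2 ^ l) - (i + 2 ^ k) ↔
      (i : ZMod m) + 2 ^ k - 1 = (j : ZMod m) + 2 ^ l - 1 := by
    rw [← ZMod.intCast_eq_intCast_iff_dvd_sub]
    push_cast
    exact sub_left_inj.symm
  simp only [key]
  constructor
  · rintro ⟨w, hi, hj⟩
    obtain ⟨-, k, hk, hwk⟩ := (knodel_adj_false_iff _ w).1 hi
    obtain ⟨-, l, hl, hwl⟩ := (knodel_adj_false_iff _ w).1 hj
    exact ⟨k, hk, l, hl, hwk.symm.trans hwl⟩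
  · rintro ⟨k, hk, l, hl, h⟩
    exact ⟨(true, (i : ZMod m) + 2 ^ k - 1), (knodel_adj_false_iff _ _).2 ⟨rfl, k, hk, rfl⟩,
      (knodel_adj_false_iff _ _).2 ⟨rfl, l, hl, h⟩⟩

theorem Int.eq_or_eq_of_dvd_sub_of_abs_lt {m a b : ℤ} (h : m ∣ a - b) (ha : |a| < m)
    (hb : |b| < m) : a = b ∨ a = b + m ∨ a = b - m := by
  obtain ⟨c, hc⟩ := h
  rw [abs_lt] at ha hb
  have h1 : c < 2 := by nlinarith
  have h2 : -2 < c := by nlinarith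
  obtain rfl | rfl | rfl : c = -1 ∨ c = 0 ∨ c = 1 := by omega
  all_goals omega

theorem idist_mem_or_sub_mem_iff {m i j : ℕ} (hi : i ≤ m) (hj : j ≤ m) (S : Set ℕ) :
    idist m i j ∈ S ∨ m - idist m i j ∈ S ↔ Nat.dist i j ∈ S ∨ m - Nat.dist i j ∈ S := by
  have hd : Nat.dist i j ≤ m := by unfold Nat.dist; omega
  unfold idist
  rcases le_total (Nat.dist i j) (m - Nat.dist i j) with h | h
  · rw [min_eq_left h]
  · rw [min_eq_right h, Nat.sub_sub_self hd, or_comm]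

/-- Lemma 1: in `W_{Δ,n}` with `Δ ≥ 2`, two distinct vertices `u_i, u_j ∈ U` have a common
neighbor iff `id(u_i,u_j) ∈ M_Δ` or `n/2 - id(u_i,u_j) ∈ M_Δ`. -/
theorem knodel_stmt_3 (n Δ : ℕ) (hn : Even n) (hn2 : 2 ≤ n)
    (hΔ : 2 ≤ Δ) (hΔ' : Δ ≤ Nat.log 2 n)
    (i j : ℕ) (hi1 : 1 ≤ i) (hj1 : 1 ≤ j) (hi2 : i ≤ n / 2) (hj2 : j ≤ n / 2) (hij : i ≠ j) :
    ((knodel Δ (n / 2)).neighborSet (false, (i : ZMod (n / 2))) ∩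
      (knodel Δ (n / 2)).neighborSet (false, (j : ZMod (n / 2)))).Nonempty ↔
    idist (n / 2) i j ∈ Mset Δ ∨ n / 2 - idist (n / 2) i j ∈ Mset Δ := by
  have hm : 2 ^ (Δ - 1) ≤ n / 2 := by
    have h := Nat.pow_le_of_le_log (by omega) hΔ'
    obtain ⟨e, rfl⟩ : ∃ e, Δ = e + 1 := ⟨Δ - 1, by omega⟩
    rw [pow_succ] at h
    rw [Nat.add_sub_cancel]
    omega
  have hpow (k : ℕ) (hk : k < Δ) : 1 ≤ 2 ^ k ∧ 2 ^ k ≤ n / 2 :=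
    ⟨Nat.one_le_two_pow, (Nat.pow_le_pow_right (by norm_num) (by omega)).trans hm⟩
  rw [knodel_common_neighbor_iff, idist_mem_or_sub_mem_iff hi2 hj2]
  generalize n / 2 = m at *
  constructor
  · rintro ⟨k, hk, l, hl, h⟩
    have hk' := hpow k hk
    have hl' := hpow l hl
    have hcases := Int.eq_or_eq_of_dvd_sub_of_abs_lt (m := m) (a := (j : ℤ) - i)
      (b := ((2 ^ k : ℕ) : ℤ) - (2 ^ l : ℕ))
      (by convert h using 1; push_cast; ring)
      (by rw [abs_lt]; omega) (by rw [abs_lt]; omega)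
    rcases lt_trichotomy k l with hkl | rfl | hkl
    · have hlt : 2 ^ k < 2 ^ l := Nat.pow_lt_pow_right (by norm_num) hkl
      have : Nat.dist i j = 2 ^ l - 2 ^ k ∨ m - Nat.dist i j = 2 ^ l - 2 ^ k := by
        unfold Nat.dist; omega
      exact this.imp (fun e => ⟨l, k, hkl, hl, e⟩) (fun e => ⟨l, k, hkl, hl, e⟩)
    · omega
    · have hlt : 2 ^ l < 2 ^ k := Nat.pow_lt_pow_right (by norm_num) hkl
      have : Nat.dist i j = 2 ^ k - 2 ^ l ∨ m - Nat.dist i j = 2 ^ k - 2 ^ l := by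
        unfold Nat.dist; omega
      exact this.imp (fun e => ⟨k, l, hkl, hk, e⟩) (fun e => ⟨k, l, hkl, hk, e⟩)
  · intro h
    obtain ⟨a, b, hba, ha, h⟩ : ∃ a b : ℕ, b < a ∧ a < Δ ∧
        (Nat.dist i j = 2 ^ a - 2 ^ b ∨ m - Nat.dist i j = 2 ^ a - 2 ^ b) := by
      rcases h with ⟨a, b, hba, ha, h⟩ | ⟨a, b, hba, ha, h⟩
      exacts [⟨a, b, hba, ha, Or.inl h⟩, ⟨a, b, hba, ha, Or.inr h⟩]
    have hlt : 2 ^ b < 2 ^ a := Nat.pow_lt_pow_right (by norm_num) hba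
    have hdvd (x y : ℕ) (hxy : (j : ℤ) + (2 ^ y : ℕ) - (i + (2 ^ x : ℕ)) = 0 ∨
        (j : ℤ) + (2 ^ y : ℕ) - (i + (2 ^ x : ℕ)) = m ∨
        (j : ℤ) + (2 ^ y : ℕ) - (i + (2 ^ x : ℕ)) = -m) :
        (m : ℤ) ∣ (j + 2 ^ y) - (i + 2 ^ x) := by
      push_cast at hxy
      rcases hxy with e | e | e <;> rw [e] <;> simp
    unfold Nat.dist at h
    have hb : b < Δ := hba.trans ha
    rcases lt_or_gt_of_ne hij with hlt' | hlt' <;> rcases h with h | h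
    · exact ⟨a, ha, b, hb, hdvd a b (by omega)⟩
    · exact ⟨b, hb, a, ha, hdvd b a (by omega)⟩
    · exact ⟨b, hb, a, ha, hdvd b a (by omega)⟩
    · exact ⟨a, ha, b, hb, hdvd a b (by omega)⟩
end

section
/- In the Knödel graph W_{Δ,n} with Δ ≥ 2, two distinct vertices u_i and u_j of U satisfy |N(u_i) ∩ N(u_j)| = 2 if and only if id(u_i, u_j) ∈ M_Δ and n/2 − id(u_i, u_j) ∈ M_Δ. -/
/-- The difference `2 ^ a - 2 ^ b > 0` determines the larger exponent. -/
theorem two_pow_sub_left_le {a b a' b' d : ℕ} (hd : 0 < d) (h : 2 ^ a = d + 2 ^ b)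
    (h' : 2 ^ a' = d + 2 ^ b') : a' ≤ a := by
  by_contra! hlt
  have hb : b' < a' := (Nat.pow_lt_pow_iff_right (a := 2) (by norm_num)).1 (by omega)
  have h1 : 2 ^ (a + 1) ≤ 2 ^ a' := Nat.pow_le_pow_right (by norm_num) hlt
  have h2 : 2 ^ (b' + 1) ≤ 2 ^ a' := Nat.pow_le_pow_right (by norm_num) hb
  have h3 : 0 < 2 ^ b := by positivity
  rw [pow_succ] at h1 h2
  omega

/-- A positive number has at most one representation as a difference of powers of two. -/
theorem two_pow_sub_unique {a b a' b' d : ℕ} (hd : 0 < d) (h : 2 ^ a = d + 2 ^ b)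
    (h' : 2 ^ a' = d + 2 ^ b') : a = a' ∧ b = b' := by
  have ha : a = a' := le_antisymm (two_pow_sub_left_le hd h' h) (two_pow_sub_left_le hd h h')
  subst ha
  exact ⟨rfl, Nat.pow_right_injective le_rfl (by dsimp only; omega)⟩

theorem mem_Mset_iff {Δ d : ℕ} (hd : 0 < d) :
    d ∈ Mset Δ ↔ ∃ a < Δ, ∃ b < Δ, 2 ^ a = d + 2 ^ b := by
  constructor
  · rintro ⟨a, b, hba, ha, rfl⟩
    have := Nat.pow_le_pow_right (n := 2) (by norm_num) hba.le
    exact ⟨a, ha, b, hba.trans ha, by omega⟩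
  · rintro ⟨a, ha, b, -, h⟩
    exact ⟨a, b, (Nat.pow_lt_pow_iff_right (a := 2) (by norm_num)).1 (by omega), ha, by omega⟩

theorem mem_knodel_neighborSet {Δ m : ℕ} (x : ZMod m) (w : Bool × ZMod m) :
    w ∈ (knodel Δ m).neighborSet (false, x) ↔ w.1 = true ∧ ∃ k < Δ, w.2 = x + 2 ^ k - 1 := by
  obtain ⟨c, y⟩ := w
  cases c <;> simp [knodel]

theorem natCast_zmod_eq_iff_of_lt {m x y : ℕ} (h1 : x < y + m) (h2 : y < x + 2 * m) :
    (x : ZMod m) = y ↔ x = y ∨ y = x + m := by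
  constructor
  · intro h
    have h' := (ZMod.intCast_eq_intCast_iff_dvd_sub (x : ℤ) (y : ℤ) m).1 (by exact_mod_cast h)
    obtain ⟨c, hc⟩ := h'
    have hc0 : -1 < c := by
      by_contra! hle
      nlinarith
    have hc2 : c < 2 := by
      by_contra! hle
      nlinarith
    have : c = 0 ∨ c = 1 := by omega
    rcases this with rfl | rfl
    · left; omega
    · right; omega
  · rintro (rfl | rfl) <;> simp

/-- The union of two disjoint sets with at most one element each has two elements iff
both are nonempty. -/
theorem ncard_union_eq_two_iff {α : Type*} {s t : Set α} (hs : s.Subsingleton)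
    (ht : t.Subsingleton) (hst : Disjoint s t) :
    (s ∪ t).ncard = 2 ↔ s.Nonempty ∧ t.Nonempty := by
  rw [Set.ncard_union_eq hst hs.finite ht.finite]
  rcases hs.eq_empty_or_singleton with rfl | ⟨x, rfl⟩ <;>
    rcases ht.eq_empty_or_singleton with rfl | ⟨y, rfl⟩ <;> simp

theorem ncard_knodel_common_neighbors_eq_two_iff {Δ m i j : ℕ} (hm : ∀ a < Δ, 2 ^ a ≤ m)
    (hij : i < j) (hjm : j < i + m) :
    ((knodel Δ m).neighborSet (false, (i : ZMod m)) ∩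
      (knodel Δ m).neighborSet (false, (j : ZMod m))).ncard = 2 ↔
    j - i ∈ Mset Δ ∧ m - (j - i) ∈ Mset Δ := by
  obtain ⟨d, rfl⟩ := Nat.exists_eq_add_of_lt hij
  set e := d + 1 with he
  have hde : i + d + 1 - i = e := by omega
  rw [hde, add_assoc, ← he]
  have he0 : 0 < e := by omega
  have hem : e < m := by omega
  have hme : 0 < m - e := by omega
  have hpos : ∀ a, 0 < 2 ^ a := fun a => by positivity
  let S : Set ℕ := {a | a < Δ ∧ ∃ b < Δ, 2 ^ a = e + 2 ^ b}
  let T : Set ℕ := {a | a < Δ ∧ ∃ b < Δ, 2 ^ b = (m - e) + 2 ^ a}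
  let f : ℕ → Bool × ZMod m := fun a => (true, (i : ZMod m) + 2 ^ a - 1)
  have hset : (knodel Δ m).neighborSet (false, (i : ZMod m)) ∩
      (knodel Δ m).neighborSet (false, ((i + e : ℕ) : ZMod m)) = f '' (S ∪ T) := by
    have key : ∀ a < Δ, ∀ b < Δ, ((i : ZMod m) + 2 ^ a - 1 = ((i + e : ℕ) : ZMod m) + 2 ^ b - 1 ↔
        2 ^ a = e + 2 ^ b ∨ 2 ^ b + e = 2 ^ a + m) := by
      intro a ha b hb
      have h1 := hm a ha
      have h2 := hm b hb
      have h3 := hpos a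
      have h4 := hpos b
      have h := natCast_zmod_eq_iff_of_lt (m := m) (x := 2 ^ a) (y := e + 2 ^ b)
        (by omega) (by omega)
      rw [add_comm (2 ^ b) e, ← h]
      push_cast
      rw [sub_left_inj, add_assoc, add_right_inj]
    ext ⟨c, y⟩
    simp only [Set.mem_inter_iff, mem_knodel_neighborSet, Set.mem_image, f, Prod.mk.injEq]
    constructor
    · rintro ⟨⟨rfl, a, ha, rfl⟩, -, b, hb, h⟩
      refine ⟨a, ?_, rfl, rfl⟩
      rcases (key a ha b hb).1 h with h | h
      · exact Or.inl ⟨ha, b, hb, h⟩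
      · exact Or.inr ⟨ha, b, hb, by omega⟩
    · rintro ⟨a, ⟨ha, b, hb, h⟩ | ⟨ha, b, hb, h⟩, rfl, rfl⟩
      · exact ⟨⟨rfl, a, ha, rfl⟩, rfl, b, hb, (key a ha b hb).2 (Or.inl h)⟩
      · exact ⟨⟨rfl, a, ha, rfl⟩, rfl, b, hb, (key a ha b hb).2 (Or.inr (by omega))⟩
  have hinj : Set.InjOn f (S ∪ T) := by
    intro a ha b hb h
    have ha' : a < Δ := ha.elim And.left And.left
    have hb' : b < Δ := hb.elim And.left And.left
    have h1 := hm a ha'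
    have h2 := hm b hb'
    have h3 := hpos a
    have h4 := hpos b
    have h5 : ((2 ^ a : ℕ) : ZMod m) = (2 ^ b : ℕ) := by
      simpa [f] using h
    have h6 := (natCast_zmod_eq_iff_of_lt (by omega) (by omega)).1 h5
    exact Nat.pow_right_injective le_rfl (by dsimp only; omega)
  rw [hset, hinj.ncard_image, ncard_union_eq_two_iff, mem_Mset_iff he0, mem_Mset_iff hme]
  · refine and_congr Iff.rfl ⟨?_, ?_⟩
    · rintro ⟨a, ha, b, hb, h⟩
      exact ⟨b, hb, a, ha, h⟩
    · rintro ⟨b, hb, a, ha, h⟩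
      exact ⟨a, ha, b, hb, h⟩
  · rintro a ⟨-, b, -, h⟩ a' ⟨-, b', -, h'⟩
    exact (two_pow_sub_unique he0 h h').1
  · rintro a ⟨-, b, -, h⟩ a' ⟨-, b', -, h'⟩
    exact (two_pow_sub_unique hme h h').2
  · rw [Set.disjoint_left]
    rintro a ⟨-, b, -, h⟩ ⟨-, c, hc, h'⟩
    have h1 := hm c hc
    have h2 := hpos b
    omega

theorem idist_mem_and_sub_mem_iff {m i j : ℕ} (s : Set ℕ) (hij : i ≤ j) (hjm : j ≤ i + m) :
    (idist m i j ∈ s ∧ m - idist m i j ∈ s) ↔ (j - i ∈ s ∧ m - (j - i) ∈ s) := by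
  rw [idist, Nat.dist_eq_sub_of_le hij]
  rcases le_total (j - i) (m - (j - i)) with h | h
  · rw [min_eq_left h]
  · rw [min_eq_right h, Nat.sub_sub_self (by omega), and_comm]

/-- Lemma 2: in `W_{Δ,n}` with `Δ ≥ 2`, two distinct vertices `u_i, u_j ∈ U` have exactly two
common neighbors iff `id(u_i,u_j) ∈ M_Δ` and `n/2 - id(u_i,u_j) ∈ M_Δ`. -/
theorem knodel_stmt_4 (n Δ : ℕ) (hn : Even n) (hn2 : 2 ≤ n)
    (hΔ : 2 ≤ Δ) (hΔ' : Δ ≤ Nat.log 2 n)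
    (i j : ℕ) (hi1 : 1 ≤ i) (hj1 : 1 ≤ j) (hi2 : i ≤ n / 2) (hj2 : j ≤ n / 2) (hij : i ≠ j) :
    ((knodel Δ (n / 2)).neighborSet (false, (i : ZMod (n / 2))) ∩
      (knodel Δ (n / 2)).neighborSet (false, (j : ZMod (n / 2)))).ncard = 2 ↔
    idist (n / 2) i j ∈ Mset Δ ∧ n / 2 - idist (n / 2) i j ∈ Mset Δ := by
  have hm : ∀ a < Δ, 2 ^ a ≤ n / 2 := by
    intro a ha
    have h1 : 2 ^ Δ ≤ n := Nat.pow_le_of_le_log (by omega) hΔ'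
    have h2 : 2 ^ (a + 1) ≤ 2 ^ Δ := Nat.pow_le_pow_right (by norm_num) ha
    rw [pow_succ] at h2
    omega
  rcases lt_or_gt_of_ne hij with h | h
  · rw [ncard_knodel_common_neighbors_eq_two_iff hm h (by omega),
      idist_mem_and_sub_mem_iff _ h.le (by omega)]
  · have hsymm : idist (n / 2) i j = idist (n / 2) j i := by
      rw [idist, idist, Nat.dist_comm]
    rw [Set.inter_comm, ncard_knodel_common_neighbors_eq_two_iff hm h (by omega), hsymm,
      idist_mem_and_sub_mem_iff _ h.le (by omega)]
end

section
/- In the Knödel graph W_{Δ,n} with Δ ≥ 2, there exist two distinct vertices having exactly two common neighbors if and only if n can be written as n = 2^a − 2^b + 2^c − 2^d for integers a, b, c, d with a > b ≥ 1, c > d ≥ 1 and a, c ≤ Δ. -/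
/-- Sums of two powers of two have essentially unique summands. -/
theorem two_pow_add_two_pow_eq {a b c d : ℕ} (h : 2 ^ a + 2 ^ b = 2 ^ c + 2 ^ d) :
    a = c ∨ a = d := by
  induction a generalizing b c d with
  | zero =>
    rcases c with _ | c
    · exact Or.inl rfl
    rcases d with _ | d
    · exact Or.inr rfl
    have hc := Nat.one_le_two_pow (n := c)
    have hd := Nat.one_le_two_pow (n := d)
    rcases b with _ | b <;> simp only [pow_succ, pow_zero] at h <;> omega
  | succ a ih =>
    have ha := Nat.one_le_two_pow (n := a)
    rcases b with _ | b <;> rcases c with _ | c <;> rcases d with _ | d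
    · simp only [pow_succ, pow_zero] at h; omega
    · right
      apply Nat.pow_right_injective le_rfl
      simp only [pow_zero] at h
      change 2 ^ (a + 1) = 2 ^ (d + 1)
      omega
    · left
      apply Nat.pow_right_injective le_rfl
      simp only [pow_zero] at h
      change 2 ^ (a + 1) = 2 ^ (c + 1)
      omega
    · simp only [pow_succ, pow_zero] at h; omega
    · have := Nat.one_le_two_pow (n := b)
      simp only [pow_succ, pow_zero] at h; omega
    · simp only [pow_succ, pow_zero] at h; omega
    · simp only [pow_succ, pow_zero] at h; omega
    · have := @ih b c d (by simp only [pow_succ] at h; omega)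
      omega

theorem two_pow_sub_two_pow_eq {k l a b : ℕ} (hab : a ≠ b)
    (h : (2 : ℤ) ^ k - 2 ^ l = 2 ^ a - 2 ^ b) : k = a := by
  have h1 : 2 ^ k + 2 ^ b = 2 ^ a + 2 ^ l := by zify; linarith
  have h2 : 2 ^ a + 2 ^ l = 2 ^ k + 2 ^ b := h1.symm
  rcases two_pow_add_two_pow_eq h2 with h | h
  · exact h.symm
  · exact absurd h hab

theorem two_pow_bounds {Δ m k : ℕ} (hm : 2 ^ Δ ≤ 2 * m) (hk : k < Δ) :
    1 ≤ (2 : ℤ) ^ k ∧ (2 : ℤ) ^ k ≤ m := by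
  constructor
  · exact one_le_pow₀ (by norm_num)
  · have : 2 ^ (k + 1) ≤ 2 ^ Δ := Nat.pow_le_pow_right (by norm_num) hk
    rw [pow_succ] at this
    exact_mod_cast (by omega : 2 ^ k ≤ m)

/-- Integers of absolute value less than `m` that are congruent modulo `m`
are equal or differ by `m`. -/
theorem eq_or_sub_eq_of_intCast_eq {m : ℕ} {A B : ℤ} (hA : |A| < m) (hB : |B| < m)
    (h : (A : ZMod m) = B) : A = B ∨ A - B = m ∨ B - A = m := by
  rw [ZMod.intCast_eq_intCast_iff_dvd_sub] at h
  obtain ⟨t, ht⟩ := h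
  rw [abs_lt] at hA hB
  have h1 : t < 2 := by nlinarith
  have h2 : -2 < t := by nlinarith
  obtain rfl | rfl | rfl : t = -1 ∨ t = 0 ∨ t = 1 := by omega
  all_goals omega

theorem abs_two_pow_sub_lt {Δ m k l : ℕ} (hm : 2 ^ Δ ≤ 2 * m) (hk : k < Δ) (hl : l < Δ) :
    |(2 : ℤ) ^ k - 2 ^ l| < m := by
  have := two_pow_bounds hm hk
  have := two_pow_bounds hm hl
  rw [abs_lt]; constructor <;> linarith

theorem two_pow_sub_congr {Δ m k l k' l' : ℕ} (hm : 2 ^ Δ ≤ 2 * m)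
    (hk : k < Δ) (hl : l < Δ) (hk' : k' < Δ) (hl' : l' < Δ)
    (h : (2 : ZMod m) ^ k - 2 ^ l = 2 ^ k' - 2 ^ l') :
    (2 : ℤ) ^ k - 2 ^ l = 2 ^ k' - 2 ^ l' ∨
    ((2 : ℤ) ^ k - 2 ^ l) - (2 ^ k' - 2 ^ l') = m ∨
    ((2 : ℤ) ^ k' - 2 ^ l') - (2 ^ k - 2 ^ l) = m :=
  eq_or_sub_eq_of_intCast_eq (abs_two_pow_sub_lt hm hk hl) (abs_two_pow_sub_lt hm hk' hl')
    (by push_cast; exact h)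

theorem lt_of_two_pow_sub_pos {k l : ℕ} (h : 0 < (2 : ℤ) ^ k - 2 ^ l) : l < k :=
  (pow_lt_pow_iff_right₀ (by norm_num : (1 : ℤ) < 2)).1 (by linarith)

/-- Two different representations of a nonzero residue as a difference of powers of two
yield a representation of the modulus. -/
theorem exists_modulus_eq {Δ m k l k' l' : ℕ} (hm : 2 ^ Δ ≤ 2 * m)
    (hk : k < Δ) (hl : l < Δ) (hk' : k' < Δ) (hl' : l' < Δ) (hkk : k ≠ k')
    (h0 : (2 : ZMod m) ^ k - 2 ^ l ≠ 0) (h : (2 : ZMod m) ^ k - 2 ^ l = 2 ^ k' - 2 ^ l') :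
    ∃ a b c d : ℕ, b < a ∧ a < Δ ∧ d < c ∧ c < Δ ∧
      (m : ℤ) = 2 ^ a - 2 ^ b + (2 ^ c - 2 ^ d) := by
  have hA := abs_lt.1 (abs_two_pow_sub_lt hm hk hl)
  have hB := abs_lt.1 (abs_two_pow_sub_lt hm hk' hl')
  rcases two_pow_sub_congr hm hk hl hk' hl' h with e | e | e
  · refine absurd (two_pow_sub_two_pow_eq ?_ e) hkk
    rintro rfl
    exact h0 (by rw [h, sub_self])
  · exact ⟨k, l, l', k', lt_of_two_pow_sub_pos (by linarith), hk,
      lt_of_two_pow_sub_pos (by linarith), hl', by linarith⟩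
  · exact ⟨k', l', l, k, lt_of_two_pow_sub_pos (by linarith), hk',
      lt_of_two_pow_sub_pos (by linarith), hl, by linarith⟩

theorem knodel_adj_false {Δ m : ℕ} {i : ZMod m} {x : Bool × ZMod m} :
    (knodel Δ m).Adj (false, i) x ↔ x.1 = true ∧ ∃ k < Δ, x.2 = i + 2 ^ k - 1 := by
  obtain ⟨s, j⟩ := x
  cases s <;> simp [knodel]

theorem knodel_adj_true {Δ m : ℕ} {j : ZMod m} {x : Bool × ZMod m} :
    (knodel Δ m).Adj (true, j) x ↔ x.1 = false ∧ ∃ k < Δ, j = x.2 + 2 ^ k - 1 := by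
  obtain ⟨s, i⟩ := x
  cases s <;> simp [knodel]

theorem exists_modulus_eq_of_common_neighbors {Δ m : ℕ} (hm : 2 ^ Δ ≤ 2 * m)
    {w₁ w₂ x y : Bool × ZMod m} (hw : w₁ ≠ w₂) (hxy : x ≠ y)
    (h1x : (knodel Δ m).Adj w₁ x) (h2x : (knodel Δ m).Adj w₂ x)
    (h1y : (knodel Δ m).Adj w₁ y) (h2y : (knodel Δ m).Adj w₂ y) :
    ∃ a b c d : ℕ, b < a ∧ a < Δ ∧ d < c ∧ c < Δ ∧
      (m : ℤ) = 2 ^ a - 2 ^ b + (2 ^ c - 2 ^ d) := by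
  obtain ⟨s, i⟩ := w₁
  obtain ⟨t, j⟩ := w₂
  obtain ⟨r, p⟩ := x
  obtain ⟨q, z⟩ := y
  cases s <;> cases t <;> simp only [knodel_adj_false, knodel_adj_true] at h1x h2x h1y h2y
  · obtain ⟨rfl, k, hk, ek⟩ := h1x
    obtain ⟨-, l, hl, el⟩ := h2x
    obtain ⟨rfl, k', hk', ek'⟩ := h1y
    obtain ⟨-, l', hl', el'⟩ := h2y
    refine exists_modulus_eq hm hk hl hk' hl' ?_ ?_ ?_
    · rintro rfl
      exact hxy (by rw [ek, ek'])
    · intro h0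
      apply hw
      congr 1
      linear_combination el - ek - h0
    · linear_combination el - ek - (el' - ek')
  · simp [h1x.1] at h2x
  · simp [h1x.1] at h2x
  · obtain ⟨rfl, k, hk, ek⟩ := h1x
    obtain ⟨-, l, hl, el⟩ := h2x
    obtain ⟨rfl, k', hk', ek'⟩ := h1y
    obtain ⟨-, l', hl', el'⟩ := h2y
    refine exists_modulus_eq hm hk hl hk' hl' ?_ ?_ ?_
    · rintro rfl
      apply hxy
      congr 1
      linear_combination ek' - ek
    · intro h0
      apply hw
      congr 1
      linear_combination ek - el + h0
    · linear_combination el - ek - (el' - ek')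

theorem exists_two_common_neighbors {Δ m a b c d : ℕ} (hm : 2 ^ Δ ≤ 2 * m)
    (hba : b < a) (ha : a < Δ) (hdc : d < c) (hc : c < Δ)
    (h : (m : ℤ) = 2 ^ a - 2 ^ b + (2 ^ c - 2 ^ d)) :
    ∃ w₁ w₂ : Bool × ZMod m, w₁ ≠ w₂ ∧
      ((knodel Δ m).neighborSet w₁ ∩ (knodel Δ m).neighborSet w₂).ncard = 2 := by
  have hb : b < Δ := hba.trans ha
  have hd : d < Δ := hdc.trans hc
  have hab : (2 : ℤ) ^ b < 2 ^ a := pow_lt_pow_right₀ (by norm_num) hba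
  have hcd : (2 : ℤ) ^ d < 2 ^ c := pow_lt_pow_right₀ (by norm_num) hdc
  have hmod : (2 : ZMod m) ^ a - 2 ^ b + (2 ^ c - 2 ^ d) = 0 := by
    have := congrArg (Int.cast : ℤ → ZMod m) h
    push_cast at this
    rw [← this, ZMod.natCast_self]
  refine ⟨(false, 0), (false, 2 ^ a - 2 ^ b), ?_, ?_⟩
  · intro e
    have e' : (0 : ZMod m) = 2 ^ a - 2 ^ b := congrArg Prod.snd e
    have := two_pow_sub_congr hm ha ha ha hb (by rw [sub_self]; exact e')
    omega
  · have hset : (knodel Δ m).neighborSet (false, 0) ∩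
        (knodel Δ m).neighborSet (false, 2 ^ a - 2 ^ b) =
        {(true, 2 ^ a - 1), (true, 2 ^ d - 1)} := by
      ext ⟨s, p⟩
      simp only [Set.mem_inter_iff, SimpleGraph.mem_neighborSet, knodel_adj_false,
        Set.mem_insert_iff, Set.mem_singleton_iff, Prod.mk.injEq]
      constructor
      · rintro ⟨⟨rfl, k, hk, ek⟩, -, l, hl, el⟩
        have e : (2 : ZMod m) ^ k - 2 ^ l = 2 ^ a - 2 ^ b := by linear_combination el - ek
        have hA := abs_lt.1 (abs_two_pow_sub_lt hm hk hl)
        rcases two_pow_sub_congr hm hk hl ha hb e with e | e | e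
        · obtain rfl := two_pow_sub_two_pow_eq hba.ne' e
          simp [ek]
        · linarith
        · obtain rfl : k = d :=
            two_pow_sub_two_pow_eq (l := l) (b := c) hdc.ne (by linarith)
          simp [ek]
      · rintro (⟨rfl, rfl⟩ | ⟨rfl, rfl⟩)
        · exact ⟨⟨rfl, a, ha, by ring⟩, rfl, b, hb, by ring⟩
        · exact ⟨⟨rfl, d, hd, by ring⟩, rfl, c, hc, by linear_combination -hmod⟩
    rw [hset, Set.ncard_pair]
    intro e
    have e' : (2 : ZMod m) ^ a - 1 = 2 ^ d - 1 := congrArg Prod.snd e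
    have hbound := two_pow_bounds hm hc
    have hbound' := two_pow_bounds hm hb
    have hA := abs_lt.1 (abs_two_pow_sub_lt hm ha hd)
    have := two_pow_sub_congr hm ha hd ha ha (by linear_combination e')
    omega

/-- Corollary 1 (ii): in `W_{Δ,n}` with `Δ ≥ 2`, there exist two distinct vertices with exactly
two common neighbors iff `n = 2^a - 2^b + 2^c - 2^d` for some `a > b ≥ 1`, `c > d ≥ 1` with
`a, c ≤ Δ`. -/
theorem knodel_stmt_6 (n Δ : ℕ) (hn : Even n) (hn2 : 2 ≤ n)
    (hΔ : 2 ≤ Δ) (hΔ' : Δ ≤ Nat.log 2 n) :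
    (∃ w₁ w₂ : Bool × ZMod (n / 2), w₁ ≠ w₂ ∧
      ((knodel Δ (n / 2)).neighborSet w₁ ∩ (knodel Δ (n / 2)).neighborSet w₂).ncard = 2) ↔
    ∃ a b c d : ℕ, 1 ≤ b ∧ b < a ∧ a ≤ Δ ∧ 1 ≤ d ∧ d < c ∧ c ≤ Δ ∧
      n = 2 ^ a - 2 ^ b + (2 ^ c - 2 ^ d) := by
  obtain ⟨m, rfl⟩ : ∃ m, n = 2 * m := even_iff_two_dvd.1 hn
  have hm : 2 ^ Δ ≤ 2 * m := Nat.pow_le_of_le_log (by omega) hΔ'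
  rw [Nat.mul_div_cancel_left m two_pos]
  constructor
  · rintro ⟨w₁, w₂, hw, hcard⟩
    obtain ⟨x, y, hxy, hset⟩ := Set.ncard_eq_two.1 hcard
    have hx : x ∈ ({x, y} : Set (Bool × ZMod m)) := by simp
    have hy : y ∈ ({x, y} : Set (Bool × ZMod m)) := by simp
    rw [← hset] at hx hy
    obtain ⟨a, b, c, d, hba, ha, hdc, hc, h⟩ :=
      exists_modulus_eq_of_common_neighbors hm hw hxy hx.1 hx.2 hy.1 hy.2
    refine ⟨a + 1, b + 1, c + 1, d + 1, by omega, by omega, by omega, by omega, by omega,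
      by omega, ?_⟩
    have hab : 2 ^ b < 2 ^ a := Nat.pow_lt_pow_right (by norm_num) hba
    have hcd : 2 ^ d < 2 ^ c := Nat.pow_lt_pow_right (by norm_num) hdc
    have h' : m + 2 ^ b + 2 ^ d = 2 ^ a + 2 ^ c := by zify; linarith
    simp only [pow_succ]
    omega
  · rintro ⟨a, b, c, d, hb, hba, ha, hd, hdc, hc, h⟩
    obtain ⟨a, rfl⟩ := Nat.exists_eq_add_of_le' (show 1 ≤ a by omega)
    obtain ⟨b, rfl⟩ := Nat.exists_eq_add_of_le' hb
    obtain ⟨c, rfl⟩ := Nat.exists_eq_add_of_le' (show 1 ≤ c by omega)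
    obtain ⟨d, rfl⟩ := Nat.exists_eq_add_of_le' hd
    refine exists_two_common_neighbors (a := a) (b := b) (c := c) (d := d) hm (by omega)
      (by omega) (by omega) (by omega) ?_
    have hab : 2 ^ b < 2 ^ a := Nat.pow_lt_pow_right (by norm_num) (by omega)
    have hcd : 2 ^ d < 2 ^ c := Nat.pow_lt_pow_right (by norm_num) (by omega)
    simp only [pow_succ] at h
    have h' : m + 2 ^ b + 2 ^ d = 2 ^ a + 2 ^ c := by omega
    zify at h'
    linarith
end

section
/- In any Knödel graph W_{Δ,n}, any three pairwise distinct vertices have at most one common neighbor; in particular, every Knödel graph contains no K_{2,3} subgraph. -/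
/-- A difference of two distinct powers of two determines the exponents. -/
theorem two_pow_sub_two_pow_injective {k l k' l' : ℕ} (h : k < l) (h' : k' < l')
    (e : (2 : ℤ) ^ l - 2 ^ k = 2 ^ l' - 2 ^ k') : k = k' ∧ l = l' := by
  have step : ∀ {i j : ℕ}, i < j → (2 : ℤ) * 2 ^ i ≤ 2 ^ j := fun {i j} hij => by
    rw [← pow_succ']
    exact pow_le_pow_right₀ (by norm_num) hij
  have hk : (0 : ℤ) < 2 ^ k := by positivity
  have hk' : (0 : ℤ) < 2 ^ k' := by positivity
  have h₁ := step h
  have h₂ := step h'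
  have hl : l = l' := by
    rcases lt_trichotomy l l' with hlt | heq | hgt
    · have := step hlt
      linarith
    · exact heq
    · have := step hgt
      linarith
  subst hl
  exact ⟨by simpa using e, rfl⟩

/-- A difference of two distinct powers of two, each at most `m`, determines the exponents
even when it is only known modulo `m`. -/
theorem two_pow_sub_two_pow_injective_zmod {m Δ k l k' l' : ℕ} (hm : 2 ^ Δ ≤ 2 * m)
    (h : k < l) (h' : k' < l') (hl : l < Δ) (hl' : l' < Δ)
    (e : (2 : ZMod m) ^ l - 2 ^ k = 2 ^ l' - 2 ^ k') : k = k' ∧ l = l' := by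
  have bounds : ∀ {i j : ℕ}, i < j → j < Δ →
      (0 : ℤ) ≤ 2 ^ j - 2 ^ i ∧ (2 : ℤ) ^ j - 2 ^ i < m := fun {i j} hij hj => by
    have h₁ : (2 : ℤ) ^ i ≤ 2 ^ j := pow_le_pow_right₀ (by norm_num) hij.le
    have h₂ : (2 : ℤ) * 2 ^ j ≤ 2 ^ Δ := by
      rw [← pow_succ']
      exact pow_le_pow_right₀ (by norm_num) hj
    have h₃ : (2 : ℤ) ^ Δ ≤ 2 * m := by exact_mod_cast hm
    have h₄ : (0 : ℤ) < 2 ^ i := by positivity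
    constructor <;> linarith
  refine two_pow_sub_two_pow_injective h h' ?_
  have e' : ((2 ^ l - 2 ^ k : ℤ) : ZMod m) = ((2 ^ l' - 2 ^ k' : ℤ) : ZMod m) := by
    push_cast
    exact e
  have e'' := (ZMod.intCast_eq_intCast_iff _ _ _).1 e'
  rwa [Int.ModEq, Int.emod_eq_of_lt (bounds h hl).1 (bounds h hl).2,
    Int.emod_eq_of_lt (bounds h' hl').1 (bounds h' hl').2] at e''

theorem knodel_adj_iff {Δ m : ℕ} {x a : Bool × ZMod m} :
    (knodel Δ m).Adj x a ↔ ∃ k < Δ,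
      (x.1 = false ∧ a = (true, x.2 + 2 ^ k - 1)) ∨ (x.1 = true ∧ a = (false, x.2 - 2 ^ k + 1)) := by
  obtain ⟨s, i⟩ := x
  obtain ⟨t, j⟩ := a
  simp only [knodel, SimpleGraph.fromRel_adj, Prod.mk.injEq, ne_eq]
  constructor
  · rintro ⟨-, ⟨hs, ht, k, hk, e⟩ | ⟨ht, hs, k, hk, e⟩⟩
    · exact ⟨k, hk, .inl ⟨hs, ht, e⟩⟩
    · exact ⟨k, hk, .inr ⟨hs, ht, by rw [e]; ring⟩⟩
  · rintro ⟨k, hk, ⟨hs, ht, e⟩ | ⟨hs, ht, e⟩⟩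
    · exact ⟨by simp [hs, ht], .inl ⟨hs, ht, k, hk, e⟩⟩
    · exact ⟨by simp [hs, ht], .inr ⟨ht, hs, k, hk, by rw [e]; ring⟩⟩

/-- A vertex of the Knödel graph has at most one neighbor along each exponent `k`, and the
exponents towards a common neighbor of `x` and `y` differ by a fixed amount as powers of two. -/
theorem exists_exponents_of_common_neighbor {Δ m : ℕ} {x y : Bool × ZMod m} (hxy : x ≠ y) :
    ∃ (f : ℕ → Bool × ZMod m) (δ : ZMod m), ∀ a, (knodel Δ m).Adj x a → (knodel Δ m).Adj y a →
      ∃ k < Δ, ∃ l < Δ, k ≠ l ∧ a = f k ∧ 2 ^ l - 2 ^ k = δ := by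
  obtain ⟨s, i⟩ := x
  obtain ⟨t, j⟩ := y
  cases s
  · refine ⟨fun k => (true, i + 2 ^ k - 1), i - j, fun a hx hy => ?_⟩
    obtain ⟨k, hk, ⟨-, rfl⟩ | ⟨h, -⟩⟩ := knodel_adj_iff.1 hx
    · obtain ⟨l, hl, ⟨ht, e⟩ | ⟨-, e⟩⟩ := knodel_adj_iff.1 hy
      · have e₂ : i + 2 ^ k - 1 = j + 2 ^ l - 1 := congrArg Prod.snd e
        refine ⟨k, hk, l, hl, ?_, rfl, by linear_combination -e₂⟩
        rintro rfl
        exact hxy (Prod.ext ht.symm (by linear_combination e₂))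
      · simp at e
    · simp at h
  · refine ⟨fun k => (false, i - 2 ^ k + 1), j - i, fun a hx hy => ?_⟩
    obtain ⟨k, hk, ⟨h, -⟩ | ⟨-, rfl⟩⟩ := knodel_adj_iff.1 hx
    · simp at h
    · obtain ⟨l, hl, ⟨-, e⟩ | ⟨ht, e⟩⟩ := knodel_adj_iff.1 hy
      · simp at e
      · have e₂ : i - 2 ^ k + 1 = j - 2 ^ l + 1 := congrArg Prod.snd e
        refine ⟨k, hk, l, hl, ?_, rfl, by linear_combination e₂⟩
        rintro rfl
        exact hxy (Prod.ext ht.symm (by linear_combination e₂))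

/-- Two distinct vertices of a Knödel graph do not have three distinct common neighbors. -/
theorem knodel_not_three_common_neighbors {Δ m : ℕ} (hm : 2 ^ Δ ≤ 2 * m)
    {x y a b c : Bool × ZMod m} (hxy : x ≠ y) (hab : a ≠ b) (hac : a ≠ c) (hbc : b ≠ c)
    (hxa : (knodel Δ m).Adj x a) (hxb : (knodel Δ m).Adj x b) (hxc : (knodel Δ m).Adj x c)
    (hya : (knodel Δ m).Adj y a) (hyb : (knodel Δ m).Adj y b) (hyc : (knodel Δ m).Adj y c) :
    False := by
  obtain ⟨f, δ, hf⟩ := exists_exponents_of_common_neighbor (Δ := Δ) hxy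
  have same : ∀ {k l k' l' : ℕ}, k < Δ → l < Δ → k' < Δ → l' < Δ →
      (2 : ZMod m) ^ l - 2 ^ k = δ → (2 : ZMod m) ^ l' - 2 ^ k' = δ →
      (k < l ∧ k' < l') ∨ (l < k ∧ l' < k') → k = k' := by
    rintro k l k' l' hk hl hk' hl' e e' (⟨h, h'⟩ | ⟨h, h'⟩)
    · exact (two_pow_sub_two_pow_injective_zmod hm h h' hl hl' (e.trans e'.symm)).1
    · exact (two_pow_sub_two_pow_injective_zmod hm h h' hk hk'
        (by linear_combination e' - e)).2
  obtain ⟨k₁, hk₁, l₁, hl₁, n₁, rfl, e₁⟩ := hf a hxa hya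
  obtain ⟨k₂, hk₂, l₂, hl₂, n₂, rfl, e₂⟩ := hf b hxb hyb
  obtain ⟨k₃, hk₃, l₃, hl₃, n₃, rfl, e₃⟩ := hf c hxc hyc
  have h₁₂ := mt (same hk₁ hl₁ hk₂ hl₂ e₁ e₂) fun h => hab (congrArg f h)
  have h₁₃ := mt (same hk₁ hl₁ hk₃ hl₃ e₁ e₃) fun h => hac (congrArg f h)
  have h₂₃ := mt (same hk₂ hl₂ hk₃ hl₃ e₂ e₃) fun h => hbc (congrArg f h)
  omega

/-- Corollary 2: in any Knödel graph `W_{Δ,n}`, any three pairwise distinct vertices have at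
most one common neighbor; in particular, `W_{Δ,n}` contains no `K_{2,3}` subgraph. -/
theorem knodel_stmt_7 (n Δ : ℕ) (hn : Even n) (hn2 : 2 ≤ n)
    (hΔ1 : 1 ≤ Δ) (hΔ' : Δ ≤ Nat.log 2 n) :
    (∀ w₁ w₂ w₃ : Bool × ZMod (n / 2), w₁ ≠ w₂ → w₁ ≠ w₃ → w₂ ≠ w₃ →
      ((knodel Δ (n / 2)).neighborSet w₁ ∩ (knodel Δ (n / 2)).neighborSet w₂ ∩
        (knodel Δ (n / 2)).neighborSet w₃).ncard ≤ 1) ∧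
    ¬ ∃ x y a b c : Bool × ZMod (n / 2), x ≠ y ∧ a ≠ b ∧ a ≠ c ∧ b ≠ c ∧
      (knodel Δ (n / 2)).Adj x a ∧ (knodel Δ (n / 2)).Adj x b ∧ (knodel Δ (n / 2)).Adj x c ∧
      (knodel Δ (n / 2)).Adj y a ∧ (knodel Δ (n / 2)).Adj y b ∧ (knodel Δ (n / 2)).Adj y c := by
  have hm : 2 ^ Δ ≤ 2 * (n / 2) := by
    rw [Nat.two_mul_div_two_of_even hn]
    exact (Nat.pow_le_pow_right (by norm_num) hΔ').trans (Nat.pow_log_le_self 2 (by omega))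
  have : NeZero (n / 2) := ⟨by omega⟩
  refine ⟨fun w₁ w₂ w₃ h₁₂ h₁₃ h₂₃ => ?_, ?_⟩
  · rw [Set.ncard_le_one (Set.toFinite _)]
    rintro x ⟨⟨hx₁, hx₂⟩, hx₃⟩ y ⟨⟨hy₁, hy₂⟩, hy₃⟩
    by_contra hxy
    exact knodel_not_three_common_neighbors hm hxy h₁₂ h₁₃ h₂₃
      hx₁.symm hx₂.symm hx₃.symm hy₁.symm hy₂.symm hy₃.symm
  · rintro ⟨x, y, a, b, c, hxy, hab, hac, hbc, hxa, hxb, hxc, hya, hyb, hyc⟩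
    exact knodel_not_three_common_neighbors hm hxy hab hac hbc hxa hxb hxc hya hyb hyc
end

section
/- In the Knödel graph W_{Δ,n} with Δ ≥ 2, if Δ < log₂(n/2 + 2) (equivalently 2^Δ − 2 < n/2), then for all 1 ≤ i < j ≤ n/2, |N(u_i) ∩ N(u_j)| = 1 if and only if id(u_i, u_j) ∈ M_Δ. -/
theorem mem_neighborSet_knodel {Δ m : ℕ} (i : ZMod m) (x : Bool × ZMod m) :
    x ∈ (knodel Δ m).neighborSet (false, i) ↔
      x.1 = true ∧ ∃ k < Δ, x.2 = i + 2 ^ k - 1 := by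
  obtain ⟨s, y⟩ := x
  cases s <;> simp [knodel]

theorem pow_two_bounds {Δ k : ℕ} (hk : k < Δ) : 1 ≤ 2 ^ k ∧ 2 * 2 ^ k ≤ 2 ^ Δ := by
  refine ⟨Nat.one_le_two_pow, ?_⟩
  rw [← pow_succ']
  exact Nat.pow_le_pow_right two_pos hk

theorem eq_of_two_pow_add_two_pow_eq_of_lt {a b c e : ℕ} (hba : b < a)
    (h : 2 ^ a + 2 ^ e = 2 ^ c + 2 ^ b) : a = c := by
  have hec : e < c := by
    by_contra! hce
    have h₁ := Nat.pow_le_pow_right two_pos hce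
    have h₂ := Nat.pow_lt_pow_right one_lt_two hba
    omega
  have hb := pow_two_bounds hba
  have he := pow_two_bounds hec
  rcases lt_trichotomy a c with hac | hac | hac
  · have := pow_two_bounds hac
    omega
  · exact hac
  · have := pow_two_bounds hac
    omega

theorem eq_of_two_pow_add_two_pow_eq {a b c e : ℕ} (hab : a ≠ b)
    (h : 2 ^ a + 2 ^ e = 2 ^ c + 2 ^ b) : a = c := by
  rcases lt_or_gt_of_ne hab with hlt | hlt
  · have hbe : b = e := eq_of_two_pow_add_two_pow_eq_of_lt (c := e) (e := c) hlt (by omega)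
    subst hbe
    exact Nat.pow_right_injective le_rfl (by simpa using h)
  · exact eq_of_two_pow_add_two_pow_eq_of_lt hlt h

/-- Two indices with `i + 2 ^ a = j + 2 ^ b` in `ZMod m` satisfy this in `ℤ` up to a multiple
of `m`. -/
theorem dvd_of_add_two_pow_eq {m i j a b : ℕ}
    (h : (i : ZMod m) + 2 ^ a - 1 = j + 2 ^ b - 1) :
    (m : ℤ) ∣ (j + 2 ^ b) - (i + 2 ^ a) := by
  rw [← ZMod.intCast_zmod_eq_zero_iff_dvd]
  push_cast
  linear_combination -h

theorem subsingleton_commonNeighbors_knodel {Δ m i j : ℕ} (hm : 2 ^ Δ < m + 2)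
    (hi : 1 ≤ i) (hij : i < j) (hj : j ≤ m) :
    ((knodel Δ m).neighborSet (false, (i : ZMod m)) ∩
      (knodel Δ m).neighborSet (false, (j : ZMod m))).Subsingleton := by
  rintro x ⟨hxi, hxj⟩ y ⟨hyi, hyj⟩
  rw [mem_neighborSet_knodel] at hxi hxj hyi hyj
  obtain ⟨hx, a, ha, hxa⟩ := hxi
  obtain ⟨-, b, hb, hxb⟩ := hxj
  obtain ⟨hy, c, hc, hyc⟩ := hyi
  obtain ⟨-, e, he, hye⟩ := hyj
  have h₁ := dvd_of_add_two_pow_eq (hxa.symm.trans hxb)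
  have h₂ := dvd_of_add_two_pow_eq (hyc.symm.trans hye)
  have hab : a ≠ b := by
    rintro rfl
    have := Int.eq_zero_of_abs_lt_dvd h₁ (by rw [abs_lt]; omega)
    omega
  have ha' := pow_two_bounds ha
  have hb' := pow_two_bounds hb
  have hc' := pow_two_bounds hc
  have he' := pow_two_bounds he
  zify at ha' hb' hc' he' hm
  have h := Int.eq_zero_of_abs_lt_dvd (dvd_sub h₁ h₂) (by rw [abs_lt]; omega)
  have hac : a = c := eq_of_two_pow_add_two_pow_eq hab (e := e) (by zify; omega)
  subst hac
  exact Prod.ext (hx.trans hy.symm) (hxa.trans hyc.symm)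

theorem nonempty_commonNeighbors_knodel_iff {Δ m i j : ℕ} (hm : 2 ^ Δ < m + 2)
    (hi : 1 ≤ i) (hij : i < j) (hj : j ≤ m) :
    ((knodel Δ m).neighborSet (false, (i : ZMod m)) ∩
      (knodel Δ m).neighborSet (false, (j : ZMod m))).Nonempty ↔
      idist m i j ∈ Mset Δ := by
  have hd : idist m i j = min (j - i) (m - (j - i)) := by
    rw [idist, Nat.dist_eq_sub_of_le hij.le]
  rw [hd]
  constructor
  · rintro ⟨x, hxi, hxj⟩
    rw [mem_neighborSet_knodel] at hxi hxj
    obtain ⟨-, a, ha, hxa⟩ := hxi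
    obtain ⟨-, b, hb, hxb⟩ := hxj
    have h₁ := dvd_of_add_two_pow_eq (hxa.symm.trans hxb)
    have ha' := pow_two_bounds ha
    have hb' := pow_two_bounds hb
    rcases lt_trichotomy a b with hab | rfl | hab
    · refine ⟨b, a, hab, hb, ?_⟩
      have hlt := Nat.pow_lt_pow_right one_lt_two hab
      have h := Int.eq_zero_of_abs_lt_dvd (dvd_sub h₁ (dvd_refl _)) (by
        rw [abs_lt]; zify at ha' hb' hm hlt; omega)
      zify at ha' hb' hm hlt
      have : (2 : ℤ) ^ b - 2 ^ a = m - (j - i) := by omega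
      zify [hlt.le]
      omega
    · have := Int.eq_zero_of_abs_lt_dvd h₁ (by rw [abs_lt]; omega)
      omega
    · refine ⟨a, b, hab, ha, ?_⟩
      have hlt := Nat.pow_lt_pow_right one_lt_two hab
      have h := Int.eq_zero_of_abs_lt_dvd h₁ (by
        rw [abs_lt]; zify at ha' hb' hm hlt; omega)
      zify at ha' hb' hm hlt
      have : (2 : ℤ) ^ a - 2 ^ b = j - i := by omega
      zify [hlt.le]
      omega
  · rintro ⟨a, b, hab, ha, h⟩
    have hlt := Nat.pow_lt_pow_right one_lt_two hab
    rcases min_choice (j - i) (m - (j - i)) with h' | h'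
    · have key : i + 2 ^ a = j + 2 ^ b := by omega
      have key' := congrArg (Nat.cast : ℕ → ZMod m) key
      push_cast at key'
      refine ⟨(true, i + 2 ^ a - 1), ?_, ?_⟩ <;> rw [mem_neighborSet_knodel]
      · exact ⟨rfl, a, ha, rfl⟩
      · exact ⟨rfl, b, hab.trans ha, by rw [key']⟩
    · have key : i + m + 2 ^ b = j + 2 ^ a := by omega
      have key' := congrArg (Nat.cast : ℕ → ZMod m) key
      push_cast at key'
      rw [ZMod.natCast_self, add_zero] at key'
      refine ⟨(true, i + 2 ^ b - 1), ?_, ?_⟩ <;> rw [mem_neighborSet_knodel]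
      · exact ⟨rfl, b, hab.trans ha, rfl⟩
      · exact ⟨rfl, a, ha, by rw [key']⟩

/-- Lemma 3 (ii): in `W_{Δ,n}` with `Δ ≥ 2` and `Δ < log₂(n/2 + 2)` (equivalently
`2^Δ - 2 < n/2`), for `1 ≤ i < j ≤ n/2`, the vertices `u_i, u_j` have exactly one common
neighbor iff `id(u_i,u_j) ∈ M_Δ`. -/
theorem knodel_stmt_9 (n Δ : ℕ) (hn : Even n) (hn2 : 2 ≤ n)
    (hΔ : 2 ≤ Δ) (hΔ' : Δ ≤ Nat.log 2 n) (hsmall : 2 ^ Δ < n / 2 + 2) :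
    ∀ i j : ℕ, 1 ≤ i → i < j → j ≤ n / 2 →
      (((knodel Δ (n / 2)).neighborSet (false, (i : ZMod (n / 2))) ∩
        (knodel Δ (n / 2)).neighborSet (false, (j : ZMod (n / 2)))).ncard = 1 ↔
      idist (n / 2) i j ∈ Mset Δ) := by
  intro i j hi hij hj
  rw [← nonempty_commonNeighbors_knodel_iff hsmall hi hij hj, Set.ncard_eq_one]
  refine ⟨fun ⟨x, hx⟩ => hx ▸ Set.singleton_nonempty x, fun ⟨x, hx⟩ => ⟨x, ?_⟩⟩
  exact (subsingleton_commonNeighbors_knodel hsmall hi hij hj).eq_singleton_of_mem hx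
end

section
/- For every even integer n ≥ 8, the total domination number of the cubic Knödel graph W_{3,n} satisfies γ_t(W_{3,n}) = 4⌈n/10⌉ if n ≡ 0, 6, or 8 (mod 10), and γ_t(W_{3,n}) = 4⌈n/10⌉ − 2 if n ≡ 2 or 4 (mod 10). -/
/-- The total domination number of a graph `G`: the minimum cardinality of a (finite) set `D`
of vertices such that every vertex of `G` has a neighbor in `D`. -/
noncomputable def totalDominationNumber {V : Type*} (G : SimpleGraph V) : ℕ :=
  sInf {k | ∃ D : Set V, D.Finite ∧ D.ncard = k ∧ ∀ v, ∃ d ∈ D, G.Adj v d}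

open Finset in
/-- In a finite abelian group, if the translates `s + {0, d, 3d}` with `s ∈ S` cover the group,
then `S` has density at least `2/5`. -/
theorem two_mul_card_le_five_mul_card_of_cover {G : Type*} [AddCommGroup G] [Fintype G]
    (d : G) (S : Finset G) (hS : ∀ x, x ∈ S ∨ x - d ∈ S ∨ x - 3 • d ∈ S) :
    2 * Fintype.card G ≤ 5 * #S := by
  classical
  let a : G → ℤ := fun x => if x ∈ S then 1 else 0
  let cov : G → ℤ := fun x => a x + a (x - d) + a (x - 3 • d)
  let b : G → ℤ := fun x => if 2 ≤ cov x then 1 else 0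
  have ha : ∀ x, a x = 0 ∨ a x = 1 := fun x => by grind
  have hcov : ∀ x, 1 ≤ cov x := fun x => by
    have := hS x
    grind
  have sum_shift (f : G → ℤ) (t : G) : ∑ x, f (x - t) = ∑ x, f x :=
    Equiv.sum_comp (Equiv.subRight t) f
  have sum_a : ∑ x, a x = #S := by simp [a]
  have sum_cov : ∑ x, cov x = 3 * #S := by
    simp only [cov, sum_add_distrib, sum_shift a, sum_a]
    ring
  -- a point covered at least twice has excess at least half of its multiplicity
  have excess : ∑ x, b x * cov x ≤ ∑ x, 2 * (cov x - 1) :=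
    sum_le_sum fun x _ => by
      have := hcov x
      by_cases h : 2 ≤ cov x <;> simp only [b, h, if_true, if_false] <;> linarith
  have double_count :
      ∑ x, b x * cov x = ∑ x, a x * (b x + b (x + d) + b (x + 3 • d)) := by
    have h₁ := sum_shift (fun x => a x * b (x + d)) d
    have h₂ := sum_shift (fun x => a x * b (x + 3 • d)) (3 • d)
    simp only [sub_add_cancel] at h₁ h₂
    simp only [cov, mul_add, sum_add_distrib, ← h₁, ← h₂, mul_comm (b _), add_mul]
  -- every translate `s + {0, d, 3d}` meets another one, since `s + 2d` has to be covered
  have overlap : ∑ x, a x ≤ ∑ x, a x * (b x + b (x + d) + b (x + 3 • d)) :=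
    sum_le_sum fun x _ => by
      have nonneg : ∀ y, 0 ≤ b y := fun y => by grind
      have b_eq_one {y : G} (h : 2 ≤ cov y) : b y = 1 := if_pos h
      have n₀ := nonneg x
      have n₁ := nonneg (x + d)
      have n₃ := nonneg (x + 3 • d)
      rcases ha x with hx | hx
      · simp [hx]
      · rw [hx, one_mul]
        rcases hS (x + 2 • d) with h | h | h
        · have hs : a (x + 3 • d - d) = 1 := if_pos (by convert h using 1; abel)
          have hb : b (x + 3 • d) = 1 := b_eq_one (by
            have := ha (x + 3 • d)
            simp only [cov, hs, add_sub_cancel_right, hx]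
            omega)
          omega
        · have hs : a (x + d) = 1 := if_pos (by convert h using 1; abel)
          have hb : b (x + d) = 1 := b_eq_one (by
            have := ha (x + d - 3 • d)
            simp only [cov, hs, add_sub_cancel_right, hx]
            omega)
          omega
        · have hs : a (x - d) = 1 := if_pos (by convert h using 1; abel)
          have hb : b x = 1 := b_eq_one (by
            have := ha (x - 3 • d)
            simp only [cov, hs, hx]
            omega)
          omega
  have sum_excess : ∑ x, 2 * (cov x - 1) = 2 * (3 * #S - Fintype.card G) := by
    rw [← mul_sum, sum_sub_distrib, sum_cov]
    simp
  zify
  linarith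

/-- The residues `0, 1, 5, 6, 10, 11, …` form a set of `⌈2m/5⌉` elements whose translates by
`0`, `1` and `3` cover `ZMod m`. -/
theorem exists_eq_pair_add (m : ℕ) [NeZero m] (x : ZMod m) :
    ∃ k < (2 * m + 4) / 5, ∃ s : ZMod m, s = ((5 * (k / 2) + k % 2 : ℕ) : ZMod m) ∧
      (x = s ∨ x = s + 1 ∨ x = s + 3) := by
  obtain ⟨y, hy, rfl⟩ : ∃ y < m, (y : ZMod m) = x :=
    ⟨x.val, x.val_lt, ZMod.natCast_zmod_val x⟩
  suffices ∃ k < (2 * m + 4) / 5, y = 5 * (k / 2) + k % 2 ∨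
      y = 5 * (k / 2) + k % 2 + 1 ∨ y = 5 * (k / 2) + k % 2 + 3 by
    obtain ⟨k, hk, h⟩ := this
    refine ⟨k, hk, _, rfl, ?_⟩
    rcases h with h | h | h
    · exact .inl (congrArg _ h)
    · exact .inr (.inl (by exact_mod_cast congrArg (Nat.cast : ℕ → ZMod m) h))
    · exact .inr (.inr (by exact_mod_cast congrArg (Nat.cast : ℕ → ZMod m) h))
  by_cases h : y % 5 = 2 ∨ y % 5 = 4
  · exact ⟨2 * (y / 5) + 1, by omega, by omega⟩
  · exact ⟨2 * (y / 5), by omega, by omega⟩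

theorem knodel_three_adj_false_true {m : ℕ} {i j : ZMod m} :
    (knodel 3 m).Adj (false, i) (true, j) ↔ j = i ∨ j = i + 1 ∨ j = i + 3 := by
  have h₁ : (i + 2 - 1 : ZMod m) = i + 1 := by ring
  have h₂ : (i + 2 ^ 2 - 1 : ZMod m) = i + 3 := by ring
  have exists_lt_three (P : ℕ → Prop) : (∃ k < 3, P k) ↔ P 0 ∨ P 1 ∨ P 2 := by
    simp only [Nat.exists_lt_succ_left, Nat.not_lt_zero, false_and, exists_false, or_false]
  simp [knodel, exists_lt_three, h₁, h₂]

theorem knodel_three_adj_false {m : ℕ} {i : ZMod m} {p : Bool × ZMod m} :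
    (knodel 3 m).Adj (false, i) p ↔
      p.1 = true ∧ (p.2 = i ∨ p.2 = i + 1 ∨ p.2 = i + 3) := by
  obtain ⟨_ | _, j⟩ := p
  · simp [knodel]
  · simp [knodel_three_adj_false_true]

theorem knodel_three_adj_true {m : ℕ} {j : ZMod m} {p : Bool × ZMod m} :
    (knodel 3 m).Adj (true, j) p ↔
      p.1 = false ∧ (j = p.2 ∨ j = p.2 + 1 ∨ j = p.2 + 3) := by
  obtain ⟨_ | _, i⟩ := p
  · rw [SimpleGraph.adj_comm]
    simp [knodel_three_adj_false_true]
  · simp [knodel]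

open Finset in
theorem totalDominationNumber_knodel_three_le (m : ℕ) [NeZero m] :
    totalDominationNumber (knodel 3 m) ≤ 2 * ((2 * m + 4) / 5) := by
  let s : ℕ → ZMod m := fun k => ((5 * (k / 2) + k % 2 : ℕ) : ZMod m)
  let R := range ((2 * m + 4) / 5)
  let D : Finset (Bool × ZMod m) :=
    R.image (fun k => (false, s k)) ∪ R.image (fun k => (true, -s k))
  have hD : #D ≤ 2 * ((2 * m + 4) / 5) := calc
    #D ≤ #R + #R := (card_union_le _ _).trans (add_le_add card_image_le card_image_le)
    _ = 2 * ((2 * m + 4) / 5) := by rw [card_range, ← two_mul]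
  refine le_trans (Nat.sInf_le ⟨D, D.finite_toSet, Set.ncard_coe_finset D, ?_⟩) hD
  rintro ⟨_ | _, x⟩
  · obtain ⟨k, hk, _, rfl, h⟩ := exists_eq_pair_add m (-x)
    refine ⟨(true, -s k), ?_, knodel_three_adj_false.2 ⟨rfl, ?_⟩⟩
    · exact mem_union_right _ (mem_image_of_mem _ (mem_range.2 hk))
    · grind
  · obtain ⟨k, hk, _, rfl, h⟩ := exists_eq_pair_add m x
    refine ⟨(false, s k), ?_, knodel_three_adj_true.2 ⟨rfl, h⟩⟩
    exact mem_union_left _ (mem_image_of_mem _ (mem_range.2 hk))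

open Finset in
theorem le_totalDominationNumber_knodel_three (m : ℕ) [NeZero m] :
    2 * ((2 * m + 4) / 5) ≤ totalDominationNumber (knodel 3 m) := by
  classical
  refine le_csInf ?_ ?_
  · refine ⟨_, Set.univ, Set.finite_univ, rfl, ?_⟩
    rintro ⟨_ | _, x⟩
    · exact ⟨(true, x), trivial, knodel_three_adj_false.2 ⟨rfl, .inl rfl⟩⟩
    · exact ⟨(false, x), trivial, knodel_three_adj_true.2 ⟨rfl, .inl rfl⟩⟩
  rintro _ ⟨D, hfin, rfl, hD⟩
  lift D to Finset (Bool × ZMod m) using hfin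
  rw [Set.ncard_coe_finset]
  let part (c : Bool) : Finset (ZMod m) := {x | (c, x) ∈ D}
  have card_D : #(part false) + #(part true) ≤ #D := by
    rw [← card_image_of_injective (part false) (Prod.mk_right_injective false),
      ← card_image_of_injective (part true) (Prod.mk_right_injective true),
      ← card_union_of_disjoint]
    · refine card_le_card (union_subset ?_ ?_) <;>
      · intro p hp
        obtain ⟨x, hx, rfl⟩ := mem_image.1 hp
        simpa [part] using hx
    · simp [disjoint_left]
  have h_false := two_mul_card_le_five_mul_card_of_cover 1 (part false) fun x => by
    obtain ⟨⟨c, y⟩, hy, h⟩ := hD (true, x)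
    obtain ⟨rfl, h⟩ := knodel_three_adj_true.1 h
    rcases h with rfl | rfl | rfl <;> simp_all [part]
  have h_true := two_mul_card_le_five_mul_card_of_cover (-1) (part true) fun x => by
    obtain ⟨⟨c, y⟩, hy, h⟩ := hD (false, x)
    obtain ⟨rfl, h⟩ := knodel_three_adj_false.1 h
    rcases h with rfl | rfl | rfl <;> simp_all [part]
  rw [ZMod.card] at h_false h_true
  have : (2 * m + 4) / 5 ≤ #(part false) := by omega
  have : (2 * m + 4) / 5 ≤ #(part true) := by omega
  omega

theorem totalDominationNumber_knodel_three (m : ℕ) [NeZero m] :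
    totalDominationNumber (knodel 3 m) = 2 * ((2 * m + 4) / 5) :=
  (totalDominationNumber_knodel_three_le m).antisymm (le_totalDominationNumber_knodel_three m)

/-- Theorem: for every even `n ≥ 8`, the total domination number of the cubic Knödel graph
`W_{3,n}` equals `4⌈n/10⌉` if `n ≡ 0, 6, 8 (mod 10)` and `4⌈n/10⌉ - 2` if
`n ≡ 2, 4 (mod 10)`. -/
theorem knodel_stmt_12 (n : ℕ) (hn : Even n) (hn8 : 8 ≤ n) :
    ((n % 10 = 0 ∨ n % 10 = 6 ∨ n % 10 = 8) →
      totalDominationNumber (knodel 3 (n / 2)) = 4 * ((n + 9) / 10)) ∧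
    ((n % 10 = 2 ∨ n % 10 = 4) →
      totalDominationNumber (knodel 3 (n / 2)) = 4 * ((n + 9) / 10) - 2) := by
  obtain ⟨m, rfl⟩ := hn
  have : NeZero ((m + m) / 2) := ⟨by omega⟩
  rw [totalDominationNumber_knodel_three]
  omega
end

section
/- For every integer t ≥ 1, the total domination number of the cubic Knödel graph W_{3,10t+2} equals 4t + 2. -/
lemma knodel_three_adj_true_left {m : ℕ} (j : ZMod m) (d : Bool × ZMod m) :
    (knodel 3 m).Adj (true, j) d ↔ d.1 = false ∧ (d.2 = j ∨ d.2 = j - 1 ∨ d.2 = j - 3) := by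
  obtain ⟨b, x⟩ := d
  cases b
  · simp only [knodel, SimpleGraph.fromRel_adj, ne_eq, Prod.mk.injEq, Bool.true_eq_false,
      false_and, not_false_eq_true, true_and, false_or]
    constructor
    · rintro ⟨k, hk, rfl⟩
      interval_cases k
      · left; ring
      · right; left; ring
      · right; right; ring
    · rintro (h | h | h)
      · exact ⟨0, by norm_num, by rw [h]; ring⟩
      · exact ⟨1, by norm_num, by rw [h]; ring⟩
      · exact ⟨2, by norm_num, by rw [h]; ring⟩
  · simp [knodel]

lemma knodel_three_adj_false_left {m : ℕ} (i : ZMod m) (d : Bool × ZMod m) :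
    (knodel 3 m).Adj (false, i) d ↔ d.1 = true ∧ (d.2 = i ∨ d.2 = i + 1 ∨ d.2 = i + 3) := by
  obtain ⟨b, x⟩ := d
  cases b
  · simp [knodel]
  · rw [SimpleGraph.adj_comm, knodel_three_adj_true_left]
    simp only [true_and, eq_sub_iff_add_eq, eq_comm]

/-- A set whose translates by `0, 1, 3` cover `ZMod m` has density at least `2/5`. -/
lemma two_mul_le_five_mul_card_of_cover {m : ℕ} [NeZero m] (A : Finset (ZMod m))
    (h : ∀ y, y ∈ A ∨ y - 1 ∈ A ∨ y - 3 ∈ A) : 2 * m ≤ 5 * A.card := by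
  classical
  let a : ZMod m → ℤ := fun z => if z ∈ A then 1 else 0
  have ha : ∀ z, a z = 0 ∨ a z = 1 := fun z => by by_cases hz : z ∈ A <;> simp [a, hz]
  have hc : ∀ z, a z = 1 ∨ a (z - 1) = 1 ∨ a (z - 3) = 1 := fun z => by
    rcases h z with h | h | h <;> simp [a, h]
  let p : ZMod m → ℤ := fun z => a z * a (z - 1)
  let n₁ : ZMod m → ℤ := fun z => (1 - a z) * a (z - 1)
  let n₂ : ZMod m → ℤ := fun z => (1 - a z) * (1 - a (z - 1)) * a (z - 2)
  let n₃ : ZMod m → ℤ := fun z => (1 - a z) * (1 - a (z - 1)) * (1 - a (z - 2))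
  have shift : ∀ (f : ZMod m → ℤ) (c : ZMod m), ∑ z, f (z - c) = ∑ z, f z := fun f c =>
    Equiv.sum_comp (Equiv.subRight c) f
  have e₁ (z : ZMod m) : z - 1 - 1 = z - 2 := by ring
  have e₂ (z : ZMod m) : z - 2 - 1 = z - 3 := by ring
  have e₃ (z : ZMod m) : z - 1 - 2 = z - 3 := by ring
  have h_total : ∑ z, (a z + n₁ z + n₂ z + n₃ z) = (m : ℤ) := by
    have (z : ZMod m) : a z + n₁ z + n₂ z + n₃ z = 1 := by simp only [n₁, n₂, n₃]; ring
    simp [this, ZMod.card]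
  have h₂p : ∑ z, n₂ z ≤ ∑ z, p (z - 2) := Finset.sum_le_sum fun z _ => by
    simp only [n₂, p, e₂]
    rcases ha z with h0 | h0 <;> rcases ha (z - 1) with h1 | h1 <;>
      rcases ha (z - 2) with h2 | h2 <;> rcases ha (z - 3) with h3 | h3 <;>
      have := hc z <;> simp_all
  have h₃₂ : ∑ z, n₃ z ≤ ∑ z, n₂ (z - 1) := Finset.sum_le_sum fun z _ => by
    simp only [n₂, n₃, e₁, e₃]
    rcases ha z with h0 | h0 <;> rcases ha (z - 1) with h1 | h1 <;>
      rcases ha (z - 2) with h2 | h2 <;> rcases ha (z - 3) with h3 | h3 <;>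
      have := hc z <;> simp_all
  have h₂₁ : ∑ z, n₂ z ≤ ∑ z, n₁ (z - 1) := Finset.sum_le_sum fun z _ => by
    simp only [n₂, n₁, e₁]
    rcases ha z with h0 | h0 <;> rcases ha (z - 1) with h1 | h1 <;>
      rcases ha (z - 2) with h2 | h2 <;> simp_all
  have h₁p : ∑ z, (n₁ z + p z) = ∑ z, a (z - 1) :=
    Finset.sum_congr rfl fun z _ => by simp only [n₁, p]; ring
  have h_card : ∑ z, a z = (A.card : ℤ) := by simp [a]
  simp only [shift, Finset.sum_add_distrib] at h_total h₂p h₃₂ h₂₁ h₁p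
  omega

lemma four_mul_add_two_le_ncard {t : ℕ} {D : Set (Bool × ZMod (5 * t + 1))}
    (hD : ∀ v, ∃ d ∈ D, (knodel 3 (5 * t + 1)).Adj v d) : 4 * t + 2 ≤ D.ncard := by
  classical
  let U : Finset (ZMod (5 * t + 1)) := {x | (false, x) ∈ D}
  let V : Finset (ZMod (5 * t + 1)) := {x | (true, -x) ∈ D}
  have hU : 2 * (5 * t + 1) ≤ 5 * U.card := two_mul_le_five_mul_card_of_cover U fun y => by
    obtain ⟨⟨b, x⟩, hd, h⟩ := hD (true, y)
    obtain ⟨rfl, h⟩ := (knodel_three_adj_true_left _ _).1 h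
    rcases h with rfl | rfl | rfl <;> simp [U, hd]
  have hV : 2 * (5 * t + 1) ≤ 5 * V.card := two_mul_le_five_mul_card_of_cover V fun y => by
    obtain ⟨⟨b, x⟩, hd, h⟩ := hD (false, -y)
    obtain ⟨rfl, h⟩ := (knodel_three_adj_false_left _ _).1 h
    rcases h with rfl | rfl | rfl <;> simp_all [V, neg_add_eq_sub]
  let φ : ZMod (5 * t + 1) ⊕ ZMod (5 * t + 1) → Bool × ZMod (5 * t + 1) :=
    Sum.elim (fun x => (false, x)) (fun x => (true, -x))
  have hφ : Function.Injective φ := by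
    rintro (x | x) (y | y) h <;> simp_all [φ]
  have hsub : (((U.disjSum V).image φ : Finset _) : Set (Bool × ZMod (5 * t + 1))) ⊆ D := by
    intro d hd
    simp only [Finset.coe_image, Set.mem_image, Finset.mem_coe] at hd
    obtain ⟨x | x, hx, rfl⟩ := hd <;> simpa [φ, U, V] using hx
  have hle := Set.ncard_le_ncard hsub D.toFinite
  rw [Set.ncard_coe_finset, Finset.card_image_of_injective _ hφ, Finset.card_disjSum] at hle
  omega

/-- The residues congruent to `0` or `1` modulo `5` cover `ZMod (5 * t + 1)` by their translates
by `0, 1, 3`. -/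
lemma exists_cover_zmod (t : ℕ) (y : ZMod (5 * t + 1)) :
    ∃ k < 2 * t + 1, ∃ x : ZMod (5 * t + 1), x = ((5 * (k / 2) + k % 2 : ℕ) : ZMod (5 * t + 1)) ∧
      (x = y ∨ x = y - 1 ∨ x = y - 3) := by
  obtain ⟨n, hn, rfl⟩ : ∃ n < 5 * t + 1, (n : ZMod (5 * t + 1)) = y :=
    ⟨y.val, y.val_lt, ZMod.natCast_zmod_val y⟩
  have sub_case (k c : ℕ) (h : 5 * (k / 2) + k % 2 + c = n) :
      ((5 * (k / 2) + k % 2 : ℕ) : ZMod (5 * t + 1)) = n - (c : ZMod (5 * t + 1)) := by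
    rw [eq_sub_iff_add_eq, ← Nat.cast_add, h]
  rcases (by omega : n % 5 = 0 ∨ n % 5 = 1 ∨ n % 5 = 2 ∨ n % 5 = 3 ∨ n % 5 = 4) with
    h | h | h | h | h
  · exact ⟨2 * (n / 5), by omega, _, rfl, .inl (by simpa using sub_case (2 * (n / 5)) 0 (by omega))⟩
  · exact ⟨2 * (n / 5) + 1, by omega, _, rfl,
      .inl (by simpa using sub_case (2 * (n / 5) + 1) 0 (by omega))⟩
  · exact ⟨2 * (n / 5) + 1, by omega, _, rfl,
      .inr (.inl (by simpa using sub_case (2 * (n / 5) + 1) 1 (by omega)))⟩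
  · exact ⟨2 * (n / 5), by omega, _, rfl,
      .inr (.inr (by simpa using sub_case (2 * (n / 5)) 3 (by omega)))⟩
  · exact ⟨2 * (n / 5) + 1, by omega, _, rfl,
      .inr (.inr (by simpa using sub_case (2 * (n / 5) + 1) 3 (by omega)))⟩

lemma exists_totalDominating_ncard_le (t : ℕ) :
    ∃ D : Set (Bool × ZMod (5 * t + 1)), D.ncard ≤ 4 * t + 2 ∧
      ∀ v, ∃ d ∈ D, (knodel 3 (5 * t + 1)).Adj v d := by
  classical
  let f : ℕ → ZMod (5 * t + 1) := fun k => ((5 * (k / 2) + k % 2 : ℕ) : ZMod (5 * t + 1))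
  let S : Finset (Bool × ZMod (5 * t + 1)) :=
    (Finset.range (2 * t + 1)).image (fun k => (false, f k)) ∪
      (Finset.range (2 * t + 1)).image (fun k => (true, -f k))
  refine ⟨S, ?_, ?_⟩
  · rw [Set.ncard_coe_finset]
    refine (Finset.card_union_le _ _).trans ?_
    have h₁ := Finset.card_image_le (s := Finset.range (2 * t + 1)) (f := fun k => (false, f k))
    have h₂ := Finset.card_image_le (s := Finset.range (2 * t + 1)) (f := fun k => (true, -f k))
    rw [Finset.card_range] at h₁ h₂
    omega
  · rintro ⟨b, y⟩
    cases b
    · obtain ⟨k, hk, x, hx, h⟩ := exists_cover_zmod t (-y)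
      refine ⟨(true, -x), ?_, (knodel_three_adj_false_left _ _).2 ⟨rfl, ?_⟩⟩
      · rw [Finset.mem_coe, Finset.mem_union]
        exact .inr (Finset.mem_image.2 ⟨k, Finset.mem_range.2 hk, by rw [hx]⟩)
      · rcases h with rfl | rfl | rfl
        · left; ring
        · right; left; ring
        · right; right; ring
    · obtain ⟨k, hk, x, hx, h⟩ := exists_cover_zmod t y
      refine ⟨(false, x), ?_, (knodel_three_adj_true_left _ _).2 ⟨rfl, h⟩⟩
      rw [Finset.mem_coe, Finset.mem_union]
      exact .inl (Finset.mem_image.2 ⟨k, Finset.mem_range.2 hk, by rw [hx]⟩)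

/-- Case 2: for every `t ≥ 1`, the total domination number of `W_{3,10t+2}` equals `4t + 2`. -/
theorem knodel_stmt_14 (t : ℕ) (ht : 1 ≤ t) :
    totalDominationNumber (knodel 3 ((10 * t + 2) / 2)) = 4 * t + 2 := by
  rw [show (10 * t + 2) / 2 = 5 * t + 1 by omega]
  obtain ⟨D, hle, hD⟩ := exists_totalDominating_ncard_le t
  refine IsLeast.csInf_eq ⟨⟨D, D.toFinite, hle.antisymm (four_mul_add_two_le_ncard hD), hD⟩, ?_⟩
  rintro _ ⟨D', -, rfl, hD'⟩
  exact four_mul_add_two_le_ncard hD'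
end

section
/- For every integer t ≥ 1, the set D_1 = {u_{5k+b}, v_{5k+b} : k = 0, 1, …, t−1; b = 1, 2} is a total dominating set of the cubic Knödel graph W_{3,10t}, and it has exactly 4t elements. -/
theorem knodel_adj_false_true {Δ m : ℕ} (i j : ZMod m) :
    (knodel Δ m).Adj (false, i) (true, j) ↔ ∃ k < Δ, j = i + 2 ^ k - 1 := by
  simp [knodel, SimpleGraph.fromRel_adj]

theorem exists_natCast_eq_of_castHom_eq {t b : ℕ} (ht : 1 ≤ t) (hb : b < 5) (x : ZMod (5 * t))
    (hx : ZMod.castHom (Dvd.intro t rfl : 5 ∣ 5 * t) (ZMod 5) x = b) :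
    ∃ k < t, x = ((5 * k + b : ℕ) : ZMod (5 * t)) := by
  have : NeZero (5 * t) := ⟨by omega⟩
  have hlt := ZMod.val_lt x
  rw [← ZMod.natCast_zmod_val x, map_natCast, ZMod.natCast_eq_natCast_iff'] at hx
  refine ⟨x.val / 5, by omega, ?_⟩
  rw [show 5 * (x.val / 5) + b = x.val by omega, ZMod.natCast_zmod_val]

/-- Every residue mod 5 reaches `1` or `2` by adding one of the offsets `2 ^ k - 1`, `k < 3`. -/
theorem exists_add_offset_zmod_five (c : ZMod 5) :
    ∃ k < 3, ∃ b : ℕ, b < 5 ∧ (b = 1 ∨ b = 2) ∧ c + 2 ^ k - 1 = (b : ZMod 5) := by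
  revert c; decide

/-- Every residue mod 5 reaches `1` or `2` by subtracting one of the offsets `2 ^ k - 1`,
`k < 3`. -/
theorem exists_sub_offset_zmod_five (c : ZMod 5) :
    ∃ k < 3, ∃ b : ℕ, b < 5 ∧ (b = 1 ∨ b = 2) ∧ c - 2 ^ k + 1 = (b : ZMod 5) := by
  revert c; decide

theorem injOn_prod_natCast_five_mul_add (t : ℕ) :
    Set.InjOn (fun p : Bool × ℕ × ℕ => (p.1, ((5 * p.2.1 + p.2.2 : ℕ) : ZMod (5 * t))))
      ((Finset.univ ×ˢ Finset.range t ×ˢ {1, 2} : Finset (Bool × ℕ × ℕ)) :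
        Set (Bool × ℕ × ℕ)) := by
  rintro ⟨s, k, b⟩ h ⟨s', k', b'⟩ h' heq
  simp only [Finset.coe_product, Set.mem_prod, Finset.mem_coe, Finset.mem_range,
    Finset.mem_insert, Finset.mem_singleton] at h h'
  simp only [Prod.mk.injEq, ZMod.natCast_eq_natCast_iff'] at heq ⊢
  obtain ⟨hs, hkb⟩ := heq
  rw [Nat.mod_eq_of_lt (by omega), Nat.mod_eq_of_lt (by omega)] at hkb
  exact ⟨hs, by omega, by omega⟩

/-- For `t ≥ 1`, the set `D₁ = {u_{5k+b}, v_{5k+b} : 0 ≤ k ≤ t-1, b ∈ {1,2}}` is a total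
dominating set of the cubic Knödel graph `W_{3,10t}` and has exactly `4t` elements. -/
theorem knodel_stmt_18 (t : ℕ) (ht : 1 ≤ t)
    (D : Set (Bool × ZMod ((10 * t) / 2)))
    (hD : D = {w | ∃ k < t, ∃ b : ℕ, (b = 1 ∨ b = 2) ∧
      (w = (false, ((5 * k + b : ℕ) : ZMod ((10 * t) / 2))) ∨
       w = (true, ((5 * k + b : ℕ) : ZMod ((10 * t) / 2))))}) :
    (∀ v, ∃ d ∈ D, (knodel 3 ((10 * t) / 2)).Adj v d) ∧ D.ncard = 4 * t := by
  have hm : 10 * t / 2 = 5 * t := by omega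
  revert D
  rw [hm]
  rintro D rfl
  constructor
  · rintro ⟨_ | _, i⟩
    · obtain ⟨k, hk, b, hb5, hb, h⟩ := exists_add_offset_zmod_five
        (ZMod.castHom (Dvd.intro t rfl : 5 ∣ 5 * t) (ZMod 5) i)
      obtain ⟨l, hl, hx⟩ := exists_natCast_eq_of_castHom_eq ht hb5 (i + 2 ^ k - 1)
        (by rw [← h]; simp only [map_sub, map_add, map_pow, map_one, map_ofNat])
      exact ⟨(true, i + 2 ^ k - 1), ⟨l, hl, b, hb, .inr (by rw [hx])⟩,
        (knodel_adj_false_true _ _).2 ⟨k, hk, rfl⟩⟩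
    · obtain ⟨k, hk, b, hb5, hb, h⟩ := exists_sub_offset_zmod_five
        (ZMod.castHom (Dvd.intro t rfl : 5 ∣ 5 * t) (ZMod 5) i)
      obtain ⟨l, hl, hx⟩ := exists_natCast_eq_of_castHom_eq ht hb5 (i - 2 ^ k + 1)
        (by rw [← h]; simp only [map_sub, map_add, map_pow, map_one, map_ofNat])
      exact ⟨(false, i - 2 ^ k + 1), ⟨l, hl, b, hb, .inl (by rw [hx])⟩,
        ((knodel_adj_false_true _ _).2 ⟨k, hk, by ring⟩).symm⟩
  · have himage : {w : Bool × ZMod (5 * t) | ∃ k < t, ∃ b : ℕ, (b = 1 ∨ b = 2) ∧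
        (w = (false, ((5 * k + b : ℕ) : ZMod (5 * t))) ∨
         w = (true, ((5 * k + b : ℕ) : ZMod (5 * t))))} =
        (fun p : Bool × ℕ × ℕ => (p.1, ((5 * p.2.1 + p.2.2 : ℕ) : ZMod (5 * t)))) ''
          ((Finset.univ ×ˢ Finset.range t ×ˢ {1, 2} : Finset (Bool × ℕ × ℕ)) :
            Set (Bool × ℕ × ℕ)) := by
      ext w
      constructor
      · rintro ⟨k, hk, b, hb, rfl | rfl⟩
        · exact ⟨(false, k, b), by simp [hk, hb], rfl⟩
        · exact ⟨(true, k, b), by simp [hk, hb], rfl⟩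
      · rintro ⟨⟨_ | _, k, b⟩, h, rfl⟩ <;>
        · simp only [Finset.coe_product, Set.mem_prod, Finset.mem_coe, Finset.mem_range,
            Finset.mem_insert, Finset.mem_singleton] at h
          exact ⟨k, h.2.1, b, h.2.2, by simp⟩
    rw [himage, (injOn_prod_natCast_five_mul_add t).ncard_image, Set.ncard_coe_finset]
    simp only [Finset.card_product, Finset.card_univ, Fintype.card_bool, Finset.card_range]
    rw [Finset.card_pair (by decide)]
    ring
end
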